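/- Let q be a nonzero complex number with q² ≠ 1, and let n ≥ 1 be an integer with [n]_q ≠ 0, [2n]_q ≠ 0 and [2]_q ≠ 0. Suppose μ, c ∈ ℂ satisfy the restriction relation c² = 1 + λ²(μ²/q² + cμ/q) together with [2n]_q μ = q[n]_q[n−1]_q c. Then there exists ε ∈ {1, −1} such that c = ε[2n]_q/([2]_q[n]_q) and μ = ε q[n−1]_q/[2]_q. -/

import Mathlib

/-- The quantum integer `[k]_q = (q^k - q^{-k})/(q - q⁻¹)`. -/
noncomputable def qint (q : ℂ) (k : ℤ) : ℂ := (q ^ k - q ^ (-k)) / (q - q⁻¹)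

lemma sub_inv_ne_zero_of_sq_ne_one {q : ℂ} (hq : q ≠ 0) (hq2 : q ^ 2 ≠ 1) : q - q⁻¹ ≠ 0 := by
  intro h
  apply hq2
  rw [sq]
  nth_rewrite 2 [sub_eq_zero.mp h]
  exact mul_inv_cancel₀ hq

lemma qint_two_mul (q : ℂ) (hq : q ≠ 0) (k : ℤ) :
    qint q (2 * k) = qint q k * (q ^ k + (q ^ k)⁻¹) := by
  unfold qint
  rw [zpow_neg, zpow_neg, two_mul, zpow_add₀ hq]
  ring

lemma qint_two (q : ℂ) (hq : q ≠ 0) (hq2 : q ^ 2 ≠ 1) : qint q 2 = q + q⁻¹ := by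
  have hl := sub_inv_ne_zero_of_sq_ne_one hq hq2
  have h := qint_two_mul q hq 1
  have h1 : qint q 1 = 1 := by
    unfold qint
    rw [zpow_neg, zpow_one]
    exact div_self hl
  simpa [h1] using h

lemma sub_inv_mul_qint_sub_one (q : ℂ) (hq : q ≠ 0) (hq2 : q ^ 2 ≠ 1) (k : ℤ) :
    (q - q⁻¹) * qint q (k - 1) = q ^ k * q⁻¹ - (q ^ k)⁻¹ * q := by
  unfold qint
  rw [mul_div_cancel₀ _ (sub_inv_ne_zero_of_sq_ne_one hq hq2), zpow_neg, zpow_sub_one₀ hq,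
    mul_inv, inv_inv]

/-- Combining the reducibility condition `[2n]_q μ = q[n]_q[n−1]_q c` with the
restriction relation forces `c = ε[2n]_q/([2]_q[n]_q)` and
`μ = ε q[n−1]_q/[2]_q` for some sign `ε = ±1`. -/
theorem restricted_reducibility_parameters
    (q : ℂ) (hq : q ≠ 0) (hq2 : q ^ 2 ≠ 1)
    (n : ℕ) (hn : 1 ≤ n)
    (hnq : qint q n ≠ 0) (h2n : qint q (2 * n) ≠ 0) (h2 : qint q 2 ≠ 0)
    (μ c : ℂ)
    (hres : c ^ 2 = 1 + (q - q⁻¹) ^ 2 * (μ ^ 2 / q ^ 2 + c * μ / q))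
    (hred : qint q (2 * n) * μ = q * qint q n * qint q ((n : ℤ) - 1) * c) :
    ∃ ε : ℂ, (ε = 1 ∨ ε = -1) ∧
      c = ε * qint q (2 * n) / (qint q 2 * qint q n) ∧
      μ = ε * q * qint q ((n : ℤ) - 1) / qint q 2 := by
  rw [qint_two_mul q hq] at h2n hred ⊢
  rw [qint_two q hq hq2] at h2 ⊢
  have hm := sub_inv_mul_qint_sub_one q hq hq2 n
  have hx : q ^ (n : ℤ) ≠ 0 := zpow_ne_zero _ hq
  have ht := right_ne_zero_of_mul h2n
  generalize qint q ((n : ℤ) - 1) = d at *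
  generalize qint q (n : ℤ) = e at *
  generalize q ^ (n : ℤ) = x at *
  obtain ⟨s, rfl⟩ : ∃ s, c = (x + x⁻¹) * s := ⟨c / (x + x⁻¹), (mul_div_cancel₀ c ht).symm⟩
  obtain rfl : μ = q * d * s := by
    apply mul_left_cancel₀ h2n
    linear_combination hred
  have key : (x + x⁻¹) ^ 2 - ((q - q⁻¹) * d) ^ 2 - (q - q⁻¹) * (x + x⁻¹) * ((q - q⁻¹) * d)
      = (q + q⁻¹) ^ 2 := by
    rw [hm]
    field_simp
    ring
  have hres' : ((x + x⁻¹) * s) ^ 2 =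
      1 + (q - q⁻¹) ^ 2 * ((d * s) ^ 2 + (x + x⁻¹) * s * (d * s)) := by
    rw [hres]
    congr 3
    · field_simp
    · field_simp
  refine ⟨(q + q⁻¹) * s, ?_, ?_, ?_⟩
  · apply eq_or_eq_neg_of_sq_eq_sq
    linear_combination hres' - s ^ 2 * key
  · rw [eq_div_iff (mul_ne_zero h2 hnq)]
    ring
  · rw [eq_div_iff h2]
    ring
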